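/- Microscopic coercivity: let α ∈ [0,1], f∞ = α M_{T∞} + (1−α)G with T∞ = (T₁+T₂)/2 and G = (M_{T₁}+M_{T₂})/2, and let H be the space L²(T×R, f∞^{−1} dx dv). Define L_α h = Π₀h + (α/(2c_α²)) Π₂(h) M_{T∞}/f∞ − h, where Π₀, Π₂ are the orthogonal projections in L²(f∞^{−1}dv) onto H₀ = f∞ and H₂ = c_α(v²/T∞ − 1)f∞ (c_α > 0 the normalizing constant). Then for all h ∈ H, ⟨h, L_α h⟩_H ≤ −((1−α)/2) ‖h − Π₀h‖_H². -/

import Mathlib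

open MeasureTheory Real Set

/-- The unit torus represented as the interval `[-1/2, 1/2]`. -/
def Torus : Set ℝ := Set.Icc (-(1:ℝ)/2) (1/2)

/-- Centered Maxwellian at temperature `T`. -/
noncomputable def Maxwellian (T v : ℝ) : ℝ :=
  (Real.sqrt (2 * Real.pi * T))⁻¹ * Real.exp (-v ^ 2 / (2 * T))

/-- The spatially homogeneous steady state `f∞ = α M_{T∞} + (1-α)(M_{T₁}+M_{T₂})/2`. -/
noncomputable def fInf (T₁ T₂ α v : ℝ) : ℝ :=
  α * Maxwellian ((T₁ + T₂) / 2) v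
    + (1 - α) * ((Maxwellian T₁ v + Maxwellian T₂ v) / 2)

/-- The projection `Π₀` onto the mass mode: `Π₀h(x,v) = (∫ h(x,w)dw) f∞(v)`. -/
noncomputable def Pi0 (T₁ T₂ α : ℝ) (h : ℝ → ℝ → ℝ) (x v : ℝ) : ℝ :=
  (∫ w : ℝ, h x w) * fInf T₁ T₂ α v

/-- The projection `Π₂` onto the energy mode `H₂ = c_α (v²/T∞ - 1) f∞`. -/
noncomputable def Pi2 (T₁ T₂ α c : ℝ) (h : ℝ → ℝ → ℝ) (x v : ℝ) : ℝ :=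
  (∫ w : ℝ, h x w * (c * (w ^ 2 / ((T₁ + T₂) / 2) - 1))) *
    (c * (v ^ 2 / ((T₁ + T₂) / 2) - 1) * fInf T₁ T₂ α v)

/-- The linearized collision operator
`L_α h = Π₀h + (α/(2c_α²)) Π₂(h) M_{T∞}/f∞ - h`. -/
noncomputable def Lop (T₁ T₂ α c : ℝ) (h : ℝ → ℝ → ℝ) (x v : ℝ) : ℝ :=
  Pi0 T₁ T₂ α h x v
    + (α / (2 * c ^ 2)) * Pi2 T₁ T₂ α c h x v *
        (Maxwellian ((T₁ + T₂) / 2) v / fInf T₁ T₂ α v)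
    - h x v

section WeightedSpace

variable {f g Y Z φ ψ : ℝ → ℝ}

lemma integrable_mul_of_integrable_sq (hf : ∀ v, 0 < f v) (hg : Measurable g) (hY : Measurable Y)
    (hgf : Integrable fun v => g v ^ 2 / f v) (hYf : Integrable fun v => Y v ^ 2 * f v) :
    Integrable fun v => g v * Y v := by
  refine (hgf.add hYf).mono' (hg.mul hY).aestronglyMeasurable (ae_of_all _ fun v => ?_)
  have hv := hf v
  have hp : 0 ≤ (g v - Y v * f v) ^ 2 / f v := by positivity
  have hm : 0 ≤ (g v + Y v * f v) ^ 2 / f v := by positivity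
  have hs : 0 ≤ g v ^ 2 / f v := by positivity
  have hs' : 0 ≤ Y v ^ 2 * f v := by positivity
  have ep : (g v - Y v * f v) ^ 2 / f v = g v ^ 2 / f v - 2 * (g v * Y v) + Y v ^ 2 * f v := by
    field_simp; ring
  have em : (g v + Y v * f v) ^ 2 / f v = g v ^ 2 / f v + 2 * (g v * Y v) + Y v ^ 2 * f v := by
    field_simp; ring
  simp only [Real.norm_eq_abs, Pi.add_apply]
  exact abs_le.2 ⟨by linarith, by linarith⟩

lemma integrable_mul_mul_weight (hf : ∀ v, 0 < f v) (hfm : Measurable f) (hY : Measurable Y)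
    (hZ : Measurable Z) (hYf : Integrable fun v => Y v ^ 2 * f v)
    (hZf : Integrable fun v => Z v ^ 2 * f v) : Integrable fun v => Y v * Z v * f v := by
  have key := integrable_mul_of_integrable_sq (g := fun v => Y v * f v) hf (hY.mul hfm) hZ
    (hYf.congr (ae_of_all _ fun v => by have := (hf v).ne'; simp only; field_simp)) hZf
  exact key.congr (ae_of_all _ fun v => by simp only; ring)

lemma two_mul_integral_mul_le (hf : ∀ v, 0 < f v) (hg : Measurable g) (hY : Measurable Y)
    (hgf : Integrable fun v => g v ^ 2 / f v) (hYf : Integrable fun v => Y v ^ 2 * f v) :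
    2 * ∫ v, g v * Y v ≤ (∫ v, g v ^ 2 / f v) + ∫ v, Y v ^ 2 * f v := by
  rw [← integral_add hgf hYf, ← integral_const_mul]
  refine integral_mono ((integrable_mul_of_integrable_sq hf hg hY hgf hYf).const_mul 2)
    (hgf.add hYf) fun v => ?_
  have hv := hf v
  have hp : 0 ≤ (g v - Y v * f v) ^ 2 / f v := by positivity
  have ep : (g v - Y v * f v) ^ 2 / f v = g v ^ 2 / f v - 2 * (g v * Y v) + Y v ^ 2 * f v := by
    field_simp; ring
  simp only
  linarith

lemma sq_integral_mul_le (hf : ∀ v, 0 < f v) (hg : Measurable g) (hY : Measurable Y)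
    (hgf : Integrable fun v => g v ^ 2 / f v) (hYf : Integrable fun v => Y v ^ 2 * f v)
    (hY1 : ∫ v, Y v ^ 2 * f v ≤ 1) :
    (∫ v, g v * Y v) ^ 2 ≤ ∫ v, g v ^ 2 / f v := by
  set S := ∫ v, g v * Y v
  have h := two_mul_integral_mul_le (Y := fun v => S * Y v) hf hg (hY.const_mul S) hgf
    ((hYf.const_mul (S ^ 2)).congr (ae_of_all _ fun v => by simp only; ring))
  have e1 : ∫ v, g v * (S * Y v) = S * S := by
    rw [← integral_const_mul]; congr 1; ext v; ring
  have e2 : ∫ v, (S * Y v) ^ 2 * f v = S ^ 2 * ∫ v, Y v ^ 2 * f v := by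
    rw [← integral_const_mul]; congr 1; ext v; ring
  rw [e1, e2] at h
  nlinarith [mul_le_mul_of_nonneg_left hY1 (sq_nonneg S)]

lemma integral_mul_integral_le {α : ℝ} (hα : 0 ≤ α) (hf : ∀ v, 0 < f v) (hfm : Measurable f)
    (hφm : Measurable φ) (hψm : Measurable ψ) (hf_int : Integrable f)
    (hφf : Integrable fun v => φ v ^ 2 * f v) (hψf : Integrable fun v => ψ v ^ 2 * f v)
    (hf1 : ∫ v, f v = 1) (hφ0 : ∫ v, φ v * f v = 0) (hψ0 : ∫ v, ψ v * f v = 0)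
    (hφ1 : ∫ v, φ v ^ 2 * f v = 1) (hψ1 : ∫ v, ψ v ^ 2 * f v ≤ 1)
    (hφψ : ∫ v, φ v * ψ v * f v = α)
    (hg : Measurable g) (hgf : Integrable fun v => g v ^ 2 / f v) :
    (∫ v, g v * φ v) * (∫ v, g v * ψ v) ≤
      (1 + α) / 2 * ((∫ v, g v ^ 2 / f v) - (∫ v, g v) ^ 2) := by
  have hone : Integrable fun v => (1 : ℝ) ^ 2 * f v := by simpa using hf_int
  have hg1 : Integrable g := by
    simpa using integrable_mul_of_integrable_sq (Y := fun _ => 1) hf hg measurable_const hgf hone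
  have hgφ := integrable_mul_of_integrable_sq hf hg hφm hgf hφf
  have hgψ := integrable_mul_of_integrable_sq hf hg hψm hgf hψf
  have hφ1f : Integrable fun v => φ v * f v := by
    simpa using integrable_mul_mul_weight (Y := φ) (Z := fun _ => 1) hf hfm hφm
      measurable_const hφf hone
  have hψ1f : Integrable fun v => ψ v * f v := by
    simpa using integrable_mul_mul_weight (Y := ψ) (Z := fun _ => 1) hf hfm hψm
      measurable_const hψf hone
  have hφψf := integrable_mul_mul_weight hf hfm hφm hψm hφf hψf
  set a := ∫ v, g v
  set e := ∫ v, g v * φ v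
  set b := ∫ v, g v * ψ v
  set l := (e + b) / (2 + 2 * α)
  let Y : ℝ → ℝ := fun v => a + l * (φ v + ψ v)
  have hYm : Measurable Y := measurable_const.add ((hφm.add hψm).const_mul l)
  have eY : (fun v => Y v ^ 2 * f v) = fun v => a ^ 2 * f v + 2 * a * l * (φ v * f v)
      + 2 * a * l * (ψ v * f v) + l ^ 2 * (φ v ^ 2 * f v) + 2 * l ^ 2 * (φ v * ψ v * f v)
      + l ^ 2 * (ψ v ^ 2 * f v) := by
    ext v; simp only [Y]; ring
  have i1 := hf_int.const_mul (a ^ 2)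
  have i2 := hφ1f.const_mul (2 * a * l)
  have i3 := hψ1f.const_mul (2 * a * l)
  have i4 := hφf.const_mul (l ^ 2)
  have i5 := hφψf.const_mul (2 * l ^ 2)
  have i6 := hψf.const_mul (l ^ 2)
  have hYf : Integrable fun v => Y v ^ 2 * f v := by
    rw [eY]; exact ((((i1.add i2).add i3).add i4).add i5).add i6
  have hYval : ∫ v, Y v ^ 2 * f v ≤ a ^ 2 + l ^ 2 * (2 + 2 * α) := by
    rw [eY, integral_add ((((i1.fun_add i2).fun_add i3).fun_add i4).fun_add i5) i6,
      integral_add (((i1.fun_add i2).fun_add i3).fun_add i4) i5,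
      integral_add ((i1.fun_add i2).fun_add i3) i4,
      integral_add (i1.fun_add i2) i3, integral_add i1 i2]
    simp only [integral_const_mul, hf1, hφ0, hψ0, hφ1, hφψ]
    nlinarith [mul_le_mul_of_nonneg_left hψ1 (sq_nonneg l)]
  have hgY : ∫ v, g v * Y v = a * a + l * (e + b) := by
    have : (fun v => g v * Y v) = fun v => a * g v + l * (g v * φ v) + l * (g v * ψ v) := by
      ext v; simp only [Y]; ring
    rw [this, integral_add ((hg1.const_mul a).fun_add (hgφ.const_mul l)) (hgψ.const_mul l),
      integral_add (hg1.const_mul a) (hgφ.const_mul l)]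
    simp only [integral_const_mul]
    ring
  have key := two_mul_integral_mul_le hf hg hYm hgf hYf
  rw [hgY] at key
  have hl : l * (2 + 2 * α) = e + b := by
    simp only [l]; field_simp
  have h3 : l ^ 2 * (2 + 2 * α) ≤ (∫ v, g v ^ 2 / f v) - a ^ 2 := by
    have : l * (e + b) = l ^ 2 * (2 + 2 * α) := by rw [← hl]; ring
    nlinarith
  have h4 : e * b ≤ (e + b) ^ 2 / 4 := by nlinarith [sq_nonneg (e - b)]
  have h5 : (e + b) ^ 2 / 4 = (1 + α) / 2 * (l ^ 2 * (2 + 2 * α)) := by rw [← hl]; ring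
  calc e * b ≤ (1 + α) / 2 * (l ^ 2 * (2 + 2 * α)) := h5 ▸ h4
    _ ≤ _ := by gcongr

lemma integral_sub_mass_sq (hf : ∀ v, 0 < f v) (hf_int : Integrable f) (hf1 : ∫ v, f v = 1)
    (hg : Measurable g) (hgf : Integrable fun v => g v ^ 2 / f v) :
    ∫ v, (g v - (∫ w, g w) * f v) ^ 2 / f v = (∫ v, g v ^ 2 / f v) - (∫ v, g v) ^ 2 := by
  have hg1 : Integrable g := by
    simpa using integrable_mul_of_integrable_sq (Y := fun _ => 1) hf hg measurable_const hgf
      (by simpa using hf_int)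
  set a := ∫ v, g v with ha
  have : (fun v => (g v - a * f v) ^ 2 / f v)
      = fun v => g v ^ 2 / f v - 2 * a * g v + a ^ 2 * f v := by
    ext v; have := (hf v).ne'; field_simp; ring
  have hsub : Integrable fun v => g v ^ 2 / f v - 2 * a * g v := hgf.sub (hg1.const_mul _)
  rw [this, integral_add hsub (hf_int.const_mul _),
    integral_sub hgf (hg1.const_mul _), integral_const_mul, integral_const_mul, hf1, ← ha]
  ring

lemma integral_mul_rank_two_sub (hf : ∀ v, 0 < f v) (hf_int : Integrable f)
    (hψm : Measurable ψ) (hψf : Integrable fun v => ψ v ^ 2 * f v)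
    (hg : Measurable g) (hgf : Integrable fun v => g v ^ 2 / f v) (a e : ℝ) :
    ∫ v, g v * (a * f v + e * (ψ v * f v) - g v) / f v
      = a * (∫ v, g v) + e * (∫ v, g v * ψ v) - ∫ v, g v ^ 2 / f v := by
  have hg1 : Integrable g := by
    simpa using integrable_mul_of_integrable_sq (Y := fun _ => 1) hf hg measurable_const hgf
      (by simpa using hf_int)
  have hgψ := integrable_mul_of_integrable_sq hf hg hψm hgf hψf
  have : (fun v => g v * (a * f v + e * (ψ v * f v) - g v) / f v)
      = fun v => a * g v + e * (g v * ψ v) - g v ^ 2 / f v := by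
    ext v; have := (hf v).ne'; field_simp
  rw [this, integral_sub ((hg1.const_mul _).fun_add (hgψ.const_mul _)) hgf,
    integral_add (hg1.const_mul _) (hgψ.const_mul _), integral_const_mul, integral_const_mul]

/-- Coercivity of a rank-two perturbation of minus the identity in a weighted `L²` space. -/
lemma setIntegral_rank_two_le {α : ℝ} (hα : 0 ≤ α) (hf : ∀ v, 0 < f v) (hfm : Measurable f)
    (hφm : Measurable φ) (hψm : Measurable ψ) (hf_int : Integrable f)
    (hφf : Integrable fun v => φ v ^ 2 * f v) (hψf : Integrable fun v => ψ v ^ 2 * f v)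
    (hf1 : ∫ v, f v = 1) (hφ0 : ∫ v, φ v * f v = 0) (hψ0 : ∫ v, ψ v * f v = 0)
    (hφ1 : ∫ v, φ v ^ 2 * f v = 1) (hψ1 : ∫ v, ψ v ^ 2 * f v ≤ 1)
    (hφψ : ∫ v, φ v * ψ v * f v = α) (s : Set ℝ) (h : ℝ → ℝ → ℝ)
    (hm : Measurable fun p : ℝ × ℝ => h p.1 p.2)
    (h2 : IntegrableOn (fun p : ℝ × ℝ => h p.1 p.2 ^ 2 / f p.2) (s ×ˢ univ)) :
    ∫ x in s, ∫ v, h x v *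
        ((∫ w, h x w) * f v + (∫ w, h x w * φ w) * (ψ v * f v) - h x v) / f v
      ≤ -((1 - α) / 2) * ∫ x in s, ∫ v, (h x v - (∫ w, h x w) * f v) ^ 2 / f v := by
  have h2' : Integrable (fun p : ℝ × ℝ => h p.1 p.2 ^ 2 / f p.2)
      ((volume.restrict s).prod volume) := by
    have := h2
    rwa [IntegrableOn, Measure.volume_eq_prod, ← Measure.prod_restrict,
      Measure.restrict_univ] at this
  have hgm : ∀ x, Measurable (h x) := fun x => hm.comp measurable_prodMk_left
  have hfib : ∀ᵐ x ∂volume.restrict s, Integrable fun v => h x v ^ 2 / f v := h2'.prod_right_ae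
  have hI : Integrable (fun x => ∫ v, h x v ^ 2 / f v) (volume.restrict s) :=
    h2'.integral_prod_left
  have hmeas : ∀ Y : ℝ → ℝ, Measurable Y → Measurable fun x => ∫ v, h x v * Y v := by
    intro Y hY
    exact (StronglyMeasurable.integral_prod_right' (ν := volume)
      (f := fun p : ℝ × ℝ => h p.1 p.2 * Y p.2)
      (hm.mul (hY.comp measurable_snd)).stronglyMeasurable).measurable
  have ha_m : Measurable fun x => ∫ v, h x v := by simpa using hmeas (fun _ => 1) measurable_const
  have he_m := hmeas φ hφm
  have hb_m := hmeas ψ hψm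
  have ha_le : ∀ᵐ x ∂volume.restrict s, (∫ v, h x v) ^ 2 ≤ ∫ v, h x v ^ 2 / f v := by
    filter_upwards [hfib] with x hx
    simpa using sq_integral_mul_le (Y := fun _ => 1) hf (hgm x) measurable_const hx
      (by simpa using hf_int) (by simp [hf1])
  have ha : Integrable (fun x => (∫ v, h x v) ^ 2) (volume.restrict s) := by
    refine hI.mono' (ha_m.pow_const 2).aestronglyMeasurable ?_
    filter_upwards [ha_le] with x hx
    rwa [Real.norm_of_nonneg (sq_nonneg _)]
  have heb : Integrable (fun x => (∫ v, h x v * φ v) * ∫ v, h x v * ψ v)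
      (volume.restrict s) := by
    refine hI.mono' (he_m.mul hb_m).aestronglyMeasurable ?_
    filter_upwards [hfib] with x hx
    have he := sq_integral_mul_le hf (hgm x) hφm hx hφf hφ1.le
    have hb := sq_integral_mul_le hf (hgm x) hψm hx hψf hψ1
    rw [Real.norm_eq_abs]
    refine abs_le.2 ⟨?_, ?_⟩
    · nlinarith [sq_nonneg ((∫ v, h x v * φ v) + ∫ v, h x v * ψ v)]
    · nlinarith [sq_nonneg ((∫ v, h x v * φ v) - ∫ v, h x v * ψ v)]
  have eL : ∀ᵐ x ∂volume.restrict s, ∫ v, h x v *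
        ((∫ w, h x w) * f v + (∫ w, h x w * φ w) * (ψ v * f v) - h x v) / f v
      = (∫ v, h x v) ^ 2 + (∫ v, h x v * φ v) * (∫ v, h x v * ψ v)
        - ∫ v, h x v ^ 2 / f v := by
    filter_upwards [hfib] with x hx
    rw [integral_mul_rank_two_sub hf hf_int hψm hψf (hgm x) hx, sq]
  have eR : ∀ᵐ x ∂volume.restrict s, ∫ v, (h x v - (∫ w, h x w) * f v) ^ 2 / f v
      = (∫ v, h x v ^ 2 / f v) - (∫ v, h x v) ^ 2 := by
    filter_upwards [hfib] with x hx
    exact integral_sub_mass_sq hf hf_int hf1 (hgm x) hx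
  rw [integral_congr_ae eL, integral_congr_ae eR, ← integral_const_mul]
  refine integral_mono_ae ((ha.add heb).sub hI) ((hI.sub ha).const_mul _) ?_
  filter_upwards [hfib] with x hx
  have := integral_mul_integral_le hα hf hfm hφm hψm hf_int hφf hψf hf1 hφ0 hψ0 hφ1 hψ1 hφψ
    (hgm x) hx
  linarith

end WeightedSpace

section Gaussian

lemma Maxwellian_pos {T : ℝ} (hT : 0 < T) (v : ℝ) : 0 < Maxwellian T v := by
  unfold Maxwellian; positivity

lemma continuous_Maxwellian (T : ℝ) : Continuous (Maxwellian T) := by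
  unfold Maxwellian; fun_prop

lemma integrable_pow_mul_Maxwellian {T : ℝ} (hT : 0 < T) (n : ℕ) :
    Integrable fun v => v ^ n * Maxwellian T v := by
  have h := integrable_rpow_mul_exp_neg_mul_sq (b := 1 / (2 * T)) (by positivity)
    (s := n) (by have := n.cast_nonneg (α := ℝ); linarith)
  refine (h.const_mul (√(2 * π * T))⁻¹).congr (ae_of_all _ fun v => ?_)
  simp only [Maxwellian, rpow_natCast]
  rw [show -(1 / (2 * T)) * v ^ 2 = -v ^ 2 / (2 * T) by ring]
  ring

lemma integrable_Maxwellian {T : ℝ} (hT : 0 < T) : Integrable (Maxwellian T) := by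
  simpa using integrable_pow_mul_Maxwellian hT 0

lemma integral_Maxwellian {T : ℝ} (hT : 0 < T) : ∫ v, Maxwellian T v = 1 := by
  have h := integral_gaussian (1 / (2 * T))
  have e : (fun v => Maxwellian T v)
      = fun v => (√(2 * π * T))⁻¹ * exp (-(1 / (2 * T)) * v ^ 2) := by
    ext v
    simp only [Maxwellian]
    rw [show -(1 / (2 * T)) * v ^ 2 = -v ^ 2 / (2 * T) by ring]
  rw [e, integral_const_mul, h, show π / (1 / (2 * T)) = 2 * π * T by field_simp]
  exact inv_mul_cancel₀ (by positivity)

lemma hasDerivAt_Maxwellian {T : ℝ} (hT : 0 < T) (v : ℝ) :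
    HasDerivAt (Maxwellian T) (-(v / T) * Maxwellian T v) v := by
  have h := (((hasDerivAt_pow 2 v).fun_neg.div_const (2 * T)).exp.const_mul (√(2 * π * T))⁻¹)
  refine h.congr_deriv ?_
  simp only [Maxwellian]
  field_simp
  norm_num

lemma integral_pow_add_two_mul_Maxwellian {T : ℝ} (hT : 0 < T) (n : ℕ) :
    ∫ v, v ^ (n + 2) * Maxwellian T v = (n + 1) * T * ∫ v, v ^ n * Maxwellian T v := by
  have hd : ∀ v, HasDerivAt (fun v => v ^ (n + 1) * Maxwellian T v)
      ((n + 1) * (v ^ n * Maxwellian T v) - T⁻¹ * (v ^ (n + 2) * Maxwellian T v)) v := by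
    intro v
    refine ((hasDerivAt_pow (n + 1) v).mul (hasDerivAt_Maxwellian hT v)).congr_deriv ?_
    push_cast
    ring
  have i0 := (integrable_pow_mul_Maxwellian hT n).const_mul ((n : ℝ) + 1)
  have i2 := (integrable_pow_mul_Maxwellian hT (n + 2)).const_mul T⁻¹
  have h := integral_eq_zero_of_hasDerivAt_of_integrable hd (i0.sub i2)
    (integrable_pow_mul_Maxwellian hT (n + 1))
  rw [integral_sub i0 i2, integral_const_mul, integral_const_mul] at h
  field_simp at h
  linarith

lemma integral_sq_mul_Maxwellian {T : ℝ} (hT : 0 < T) : ∫ v, v ^ 2 * Maxwellian T v = T := by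
  simpa [integral_Maxwellian hT] using integral_pow_add_two_mul_Maxwellian hT 0

lemma integral_pow_four_mul_Maxwellian {T : ℝ} (hT : 0 < T) :
    ∫ v, v ^ 4 * Maxwellian T v = 3 * T ^ 2 := by
  have h := integral_pow_add_two_mul_Maxwellian hT 2
  rw [integral_sq_mul_Maxwellian hT] at h
  norm_num at h
  rw [h]; ring

lemma integrable_energy_mul_Maxwellian {s : ℝ} (hs : 0 < s) (T : ℝ) :
    Integrable fun v => (v ^ 2 / T - 1) * Maxwellian s v :=
  (((integrable_pow_mul_Maxwellian hs 2).const_mul T⁻¹).sub (integrable_Maxwellian hs)).congr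
    (ae_of_all _ fun v => by simp only [Pi.sub_apply]; ring)

lemma integral_energy_mul_Maxwellian {s : ℝ} (hs : 0 < s) (T : ℝ) :
    ∫ v, (v ^ 2 / T - 1) * Maxwellian s v = s / T - 1 := by
  have e : (fun v => (v ^ 2 / T - 1) * Maxwellian s v)
      = fun v => T⁻¹ * (v ^ 2 * Maxwellian s v) - Maxwellian s v := by ext v; ring
  rw [e, integral_sub ((integrable_pow_mul_Maxwellian hs 2).const_mul T⁻¹)
    (integrable_Maxwellian hs), integral_const_mul, integral_sq_mul_Maxwellian hs,
    integral_Maxwellian hs]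
  ring

lemma energy_sq_mul_Maxwellian_eq (s T : ℝ) :
    (fun v => (v ^ 2 / T - 1) ^ 2 * Maxwellian s v) = fun v => T⁻¹ ^ 2 * (v ^ 4 * Maxwellian s v)
      - 2 * T⁻¹ * (v ^ 2 * Maxwellian s v) + Maxwellian s v := by
  ext v; ring

lemma integrable_energy_sq_mul_Maxwellian {s : ℝ} (hs : 0 < s) (T : ℝ) :
    Integrable fun v => (v ^ 2 / T - 1) ^ 2 * Maxwellian s v := by
  rw [energy_sq_mul_Maxwellian_eq]
  exact (((integrable_pow_mul_Maxwellian hs 4).const_mul _).sub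
    ((integrable_pow_mul_Maxwellian hs 2).const_mul _)).add (integrable_Maxwellian hs)

lemma integral_energy_sq_mul_Maxwellian {s : ℝ} (hs : 0 < s) (T : ℝ) :
    ∫ v, (v ^ 2 / T - 1) ^ 2 * Maxwellian s v = 3 * (s / T) ^ 2 - 2 * (s / T) + 1 := by
  have i4 := (integrable_pow_mul_Maxwellian hs 4).const_mul (T⁻¹ ^ 2)
  have i2 := (integrable_pow_mul_Maxwellian hs 2).const_mul (2 * T⁻¹)
  have hsub : Integrable fun v => T⁻¹ ^ 2 * (v ^ 4 * Maxwellian s v)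
      - 2 * T⁻¹ * (v ^ 2 * Maxwellian s v) := i4.sub i2
  rw [energy_sq_mul_Maxwellian_eq, integral_add hsub (integrable_Maxwellian hs),
    integral_sub i4 i2, integral_const_mul, integral_const_mul,
    integral_pow_four_mul_Maxwellian hs, integral_sq_mul_Maxwellian hs, integral_Maxwellian hs]
  ring

/-- The quotient `M_T² / M_τ` is a multiple of a Maxwellian when `τ > T / 2`. -/
lemma Maxwellian_sq_div_Maxwellian {T t r : ℝ} (hT : 0 < T) (ht : 0 < t) (hr : 0 < r)
    (hrt : r ^ 2 = 2 * t - 1) (v : ℝ) :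
    Maxwellian T v ^ 2 / Maxwellian (t * T) v = t / r * Maxwellian (T * t / r ^ 2) v := by
  have hs : √(2 * π * (T * t / r ^ 2)) = √(2 * π * T * t) / r := by
    rw [show 2 * π * (T * t / r ^ 2) = 2 * π * T * t / r ^ 2 by ring, Real.sqrt_div (by positivity),
      Real.sqrt_sq hr.le]
  have ht' : √(2 * π * (t * T)) = √(2 * π * T * t) := by congr 1; ring
  have hT2 : √(2 * π * T) ^ 2 = 2 * π * T := Real.sq_sqrt (by positivity)
  have hTt2 : √(2 * π * T * t) ^ 2 = 2 * π * T * t := Real.sq_sqrt (by positivity)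
  have hexp : exp (-v ^ 2 / (2 * T)) ^ 2
      = exp (-v ^ 2 / (2 * (T * t / r ^ 2))) * exp (-v ^ 2 / (2 * (t * T))) := by
    rw [← Real.exp_nat_mul, ← Real.exp_add]
    congr 1
    rw [hrt]
    have : 2 * t - 1 ≠ 0 := by rw [← hrt]; positivity
    field_simp
    push_cast
    ring
  have hp : 0 < √(2 * π * T * t) := by positivity
  have hpT : 0 < √(2 * π * T) := by positivity
  unfold Maxwellian
  rw [hs, ht', mul_pow, hexp, inv_pow, hT2]
  field_simp
  rw [hTt2]

/-- The `M_T² / M_τ` energy moment is at most the `M_T` energy moment, for `T ≤ τ ≤ 2T`. -/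
lemma integral_energy_sq_mul_Maxwellian_sq_div {T τ : ℝ} (hT : 0 < T) (hτ : T ≤ τ)
    (hτ2 : τ ≤ 2 * T) :
    Integrable (fun v => (v ^ 2 / T - 1) ^ 2 * (Maxwellian T v ^ 2 / Maxwellian τ v)) ∧
      ∫ v, (v ^ 2 / T - 1) ^ 2 * (Maxwellian T v ^ 2 / Maxwellian τ v) ≤ 2 := by
  obtain ⟨t, rfl⟩ : ∃ t, τ = t * T := ⟨τ / T, by field_simp⟩
  have ht1 : 1 ≤ t := by nlinarith
  have ht2 : t ≤ 2 := by nlinarith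
  set r := √(2 * t - 1)
  have hr2 : r ^ 2 = 2 * t - 1 := Real.sq_sqrt (by linarith)
  have hr : 1 ≤ r := Real.one_le_sqrt.2 (by linarith)
  have hr0 : 0 < r := by linarith
  have ht0 : 0 < t := by linarith
  have hs : 0 < T * t / r ^ 2 := by positivity
  have e : (fun v => (v ^ 2 / T - 1) ^ 2 * (Maxwellian T v ^ 2 / Maxwellian (t * T) v))
      = fun v => t / r * ((v ^ 2 / T - 1) ^ 2 * Maxwellian (T * t / r ^ 2) v) := by
    ext v
    rw [Maxwellian_sq_div_Maxwellian hT ht0 hr0 hr2]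
    ring
  rw [e]
  refine ⟨(integrable_energy_sq_mul_Maxwellian hs T).const_mul _, ?_⟩
  rw [integral_const_mul, integral_energy_sq_mul_Maxwellian hs,
    show T * t / r ^ 2 / T = t / r ^ 2 by field_simp]
  have ht : t = (r ^ 2 + 1) / 2 := by linarith
  have hr3 : r ≤ 2 := by nlinarith
  have hpoly : (r ^ 2 + 1) * (3 * r ^ 4 + 2 * r ^ 2 + 3) ≤ 16 * r ^ 5 := by
    have h1 : 0 ≤ (r - 1) * (r ^ 4 * (13 - 3 * r) + 8 * r ^ 3 + 8 * r ^ 2 + 3 * r + 3) := by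
      have : 0 ≤ 13 - 3 * r := by linarith
      have : 0 ≤ r - 1 := by linarith
      positivity
    nlinarith
  have : t / r * (3 * (t / r ^ 2) ^ 2 - 2 * (t / r ^ 2) + 1)
      = (r ^ 2 + 1) * (3 * r ^ 4 + 2 * r ^ 2 + 3) / (8 * r ^ 5) := by
    rw [ht]; field_simp; ring
  rw [this, div_le_iff₀ (by positivity)]
  linarith

end Gaussian

section SteadyState

variable {T₁ T₂ α : ℝ}

lemma fInf_pos (hT₁ : 0 < T₁) (hT₂ : 0 < T₂) (hα : α ∈ Set.Icc (0:ℝ) 1) (v : ℝ) :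
    0 < fInf T₁ T₂ α v := by
  have hM := Maxwellian_pos (T := (T₁ + T₂) / 2) (by positivity) v
  have hM₁ := Maxwellian_pos hT₁ v
  have hM₂ := Maxwellian_pos hT₂ v
  have hβ : 0 ≤ 1 - α := sub_nonneg.2 hα.2
  unfold fInf
  rcases hα.1.eq_or_lt with h0 | h0
  · rw [← h0]; simp only [zero_mul, sub_zero, one_mul]; positivity
  · positivity

lemma continuous_fInf (T₁ T₂ α : ℝ) : Continuous (fInf T₁ T₂ α) := by
  have h := continuous_Maxwellian ((T₁ + T₂) / 2)
  have h₁ := continuous_Maxwellian T₁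
  have h₂ := continuous_Maxwellian T₂
  unfold fInf
  fun_prop

lemma mul_fInf_eq (w : ℝ → ℝ) : (fun v => w v * fInf T₁ T₂ α v)
    = fun v => α * (w v * Maxwellian ((T₁ + T₂) / 2) v)
      + (1 - α) / 2 * (w v * Maxwellian T₁ v) + (1 - α) / 2 * (w v * Maxwellian T₂ v) := by
  ext v; unfold fInf; ring

lemma integrable_mul_fInf (hT₁ : 0 < T₁) (hT₂ : 0 < T₂) {w : ℝ → ℝ}
    (hw : ∀ s, 0 < s → Integrable fun v => w v * Maxwellian s v) :
    Integrable fun v => w v * fInf T₁ T₂ α v := by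
  rw [mul_fInf_eq]
  exact (((hw _ (by positivity)).const_mul _).add ((hw _ hT₁).const_mul _)).add
    ((hw _ hT₂).const_mul _)

lemma integral_mul_fInf (hT₁ : 0 < T₁) (hT₂ : 0 < T₂) {w : ℝ → ℝ}
    (hw : ∀ s, 0 < s → Integrable fun v => w v * Maxwellian s v) :
    ∫ v, w v * fInf T₁ T₂ α v = α * (∫ v, w v * Maxwellian ((T₁ + T₂) / 2) v)
      + (1 - α) / 2 * (∫ v, w v * Maxwellian T₁ v)
      + (1 - α) / 2 * ∫ v, w v * Maxwellian T₂ v := by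
  have i0 := (hw ((T₁ + T₂) / 2) (by positivity)).const_mul α
  have i1 := (hw _ hT₁).const_mul ((1 - α) / 2)
  have i2 := (hw _ hT₂).const_mul ((1 - α) / 2)
  rw [mul_fInf_eq, integral_add (i0.fun_add i1) i2, integral_add i0 i1, integral_const_mul,
    integral_const_mul, integral_const_mul]

lemma integrable_fInf (hT₁ : 0 < T₁) (hT₂ : 0 < T₂) : Integrable (fInf T₁ T₂ α) := by
  simpa using integrable_mul_fInf (α := α) hT₁ hT₂ (w := fun _ => 1)
    fun s hs => by simpa using integrable_Maxwellian hs

lemma integral_fInf (hT₁ : 0 < T₁) (hT₂ : 0 < T₂) : ∫ v, fInf T₁ T₂ α v = 1 := by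
  have h := integral_mul_fInf (α := α) hT₁ hT₂ (w := fun _ => 1)
    fun s hs => by simpa using integrable_Maxwellian hs
  simp only [one_mul, integral_Maxwellian hT₁, integral_Maxwellian hT₂,
    integral_Maxwellian (T := (T₁ + T₂) / 2) (by positivity)] at h
  rw [h]; ring

lemma integral_energy_mul_fInf (hT₁ : 0 < T₁) (hT₂ : 0 < T₂) :
    ∫ v, (v ^ 2 / ((T₁ + T₂) / 2) - 1) * fInf T₁ T₂ α v = 0 := by
  rw [integral_mul_fInf hT₁ hT₂ fun s hs => integrable_energy_mul_Maxwellian hs _,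
    integral_energy_mul_Maxwellian hT₁, integral_energy_mul_Maxwellian hT₂,
    integral_energy_mul_Maxwellian (by positivity)]
  field_simp
  ring

lemma integral_energy_sq_mul_fInf_le (hT₁ : 0 < T₁) (hT₂ : 0 < T₂) (hα1 : α ≤ 1) :
    ∫ v, (v ^ 2 / ((T₁ + T₂) / 2) - 1) ^ 2 * fInf T₁ T₂ α v ≤ 2 * α + 5 * (1 - α) := by
  rw [integral_mul_fInf hT₁ hT₂ fun s hs => integrable_energy_sq_mul_Maxwellian hs _,
    integral_energy_sq_mul_Maxwellian hT₁, integral_energy_sq_mul_Maxwellian hT₂,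
    integral_energy_sq_mul_Maxwellian (by positivity)]
  set x := T₁ / ((T₁ + T₂) / 2)
  set y := T₂ / ((T₁ + T₂) / 2)
  have hx : 0 < x := by positivity
  have hy : 0 < y := by positivity
  have hxy : x + y = 2 := by simp only [x, y]; field_simp
  rw [div_self (by positivity)]
  have hW : 3 * x ^ 2 - 2 * x + 1 + (3 * y ^ 2 - 2 * y + 1) ≤ 10 := by
    nlinarith [mul_pos hx hy]
  nlinarith [mul_le_mul_of_nonneg_left hW (sub_nonneg.2 hα1)]

lemma sq_Maxwellian_div_fInf_le (hT₁ : 0 < T₁) (hT₂ : 0 < T₂) (hα : α ∈ Set.Icc (0:ℝ) 1)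
    (v : ℝ) :
    α ^ 2 * (Maxwellian ((T₁ + T₂) / 2) v ^ 2 / fInf T₁ T₂ α v)
      ≤ α * (1 + α) ^ 2 / 4 * Maxwellian ((T₁ + T₂) / 2) v
        + α ^ 2 * (1 - α) / 2
          * (Maxwellian ((T₁ + T₂) / 2) v ^ 2 / Maxwellian (max T₁ T₂) v) := by
  have hf := fInf_pos hT₁ hT₂ hα v
  have hM := Maxwellian_pos (T := (T₁ + T₂) / 2) (by positivity) v
  have hM₁ := Maxwellian_pos hT₁ v
  have hM₂ := Maxwellian_pos hT₂ v
  have hg := Maxwellian_pos (lt_max_of_lt_left hT₁ : 0 < max T₁ T₂) v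
  have hβ : 0 ≤ 1 - α := sub_nonneg.2 hα.2
  have hα0 := hα.1
  have hle : α * Maxwellian ((T₁ + T₂) / 2) v + (1 - α) * (Maxwellian (max T₁ T₂) v / 2)
      ≤ fInf T₁ T₂ α v := by
    unfold fInf
    gcongr
    rcases max_choice T₁ T₂ with h | h <;> rw [h] <;> linarith
  generalize fInf T₁ T₂ α v = f at *
  generalize Maxwellian ((T₁ + T₂) / 2) v = M at *
  generalize Maxwellian (max T₁ T₂) v = g at *
  have hB : 0 ≤ α * (1 + α) ^ 2 / 4 * M + α ^ 2 * (1 - α) / 2 * (M ^ 2 / g) := by positivity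
  rw [← mul_div_assoc, div_le_iff₀ hf]
  refine le_trans ?_ (mul_le_mul_of_nonneg_left hle hB)
  have key : 0 ≤ α * (1 - α) * M / (8 * g) * (2 * α * M - (1 + α) * g) ^ 2 := by positivity
  have : (α * (1 + α) ^ 2 / 4 * M + α ^ 2 * (1 - α) / 2 * (M ^ 2 / g))
      * (α * M + (1 - α) * (g / 2)) - α ^ 2 * M ^ 2
      = α * (1 - α) * M / (8 * g) * (2 * α * M - (1 + α) * g) ^ 2 := by
    field_simp
    ring
  linarith

lemma integral_energy_sq_mul_sq_Maxwellian_div_fInf (hT₁ : 0 < T₁) (hT₂ : 0 < T₂)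
    (hα : α ∈ Set.Icc (0:ℝ) 1) :
    Integrable (fun v => (v ^ 2 / ((T₁ + T₂) / 2) - 1) ^ 2
        * (α ^ 2 * (Maxwellian ((T₁ + T₂) / 2) v ^ 2 / fInf T₁ T₂ α v))) ∧
      ∫ v, (v ^ 2 / ((T₁ + T₂) / 2) - 1) ^ 2
        * (α ^ 2 * (Maxwellian ((T₁ + T₂) / 2) v ^ 2 / fInf T₁ T₂ α v))
      ≤ α * (1 + α) ^ 2 / 2 + α ^ 2 * (1 - α) := by
  have hT : 0 < (T₁ + T₂) / 2 := by positivity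
  have hβ : 0 ≤ 1 - α := sub_nonneg.2 hα.2
  have hα0 := hα.1
  obtain ⟨iτ, hτ⟩ := integral_energy_sq_mul_Maxwellian_sq_div (τ := max T₁ T₂) hT
    (by linarith [le_max_left T₁ T₂, le_max_right T₁ T₂]) (by apply max_le <;> linarith)
  have iM := (integrable_energy_sq_mul_Maxwellian hT ((T₁ + T₂) / 2)).const_mul
    (α * (1 + α) ^ 2 / 4)
  have iτ' := iτ.const_mul (α ^ 2 * (1 - α) / 2)
  have hpt : ∀ v : ℝ, (v ^ 2 / ((T₁ + T₂) / 2) - 1) ^ 2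
        * (α ^ 2 * (Maxwellian ((T₁ + T₂) / 2) v ^ 2 / fInf T₁ T₂ α v))
      ≤ α * (1 + α) ^ 2 / 4
          * ((v ^ 2 / ((T₁ + T₂) / 2) - 1) ^ 2 * Maxwellian ((T₁ + T₂) / 2) v)
        + α ^ 2 * (1 - α) / 2 * ((v ^ 2 / ((T₁ + T₂) / 2) - 1) ^ 2
          * (Maxwellian ((T₁ + T₂) / 2) v ^ 2 / Maxwellian (max T₁ T₂) v)) := fun v =>
    (mul_le_mul_of_nonneg_left (sq_Maxwellian_div_fInf_le hT₁ hT₂ hα v)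
      (sq_nonneg _)).trans_eq (by ring)
  have hmeas : Measurable fun v : ℝ => (v ^ 2 / ((T₁ + T₂) / 2) - 1) ^ 2
      * (α ^ 2 * (Maxwellian ((T₁ + T₂) / 2) v ^ 2 / fInf T₁ T₂ α v)) := by
    have h1 := (continuous_Maxwellian ((T₁ + T₂) / 2)).measurable
    have h2 := (continuous_fInf T₁ T₂ α).measurable
    fun_prop
  have hint : Integrable fun v : ℝ => (v ^ 2 / ((T₁ + T₂) / 2) - 1) ^ 2
      * (α ^ 2 * (Maxwellian ((T₁ + T₂) / 2) v ^ 2 / fInf T₁ T₂ α v)) := by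
    refine (iM.fun_add iτ').mono' hmeas.aestronglyMeasurable (ae_of_all _ fun v => ?_)
    have := fInf_pos hT₁ hT₂ hα v
    rw [Real.norm_of_nonneg (by positivity)]
    exact hpt v
  refine ⟨hint, (integral_mono hint (iM.fun_add iτ') hpt).trans ?_⟩
  rw [integral_add iM iτ', integral_const_mul, integral_const_mul,
    integral_energy_sq_mul_Maxwellian hT, div_self hT.ne']
  have := mul_le_mul_of_nonneg_left hτ (by positivity : 0 ≤ α ^ 2 * (1 - α) / 2)
  linarith

end SteadyState

theorem microscopic_coercivity
    (T₁ T₂ α c : ℝ) (hT₁ : 0 < T₁) (hT₂ : 0 < T₂)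
    (hα : α ∈ Set.Icc (0:ℝ) 1) (hc : 0 < c)
    -- normalization `‖H₂‖_{L²(f∞⁻¹ dv)} = 1`
    (hc_norm : ∫ v : ℝ,
        (c * (v ^ 2 / ((T₁ + T₂) / 2) - 1)) ^ 2 * fInf T₁ T₂ α v = 1)
    (h : ℝ → ℝ → ℝ)
    (h_meas : Measurable (fun p : ℝ × ℝ => h p.1 p.2))
    -- `h` belongs to `H = L²(T×ℝ, f∞⁻¹ dx dv)`
    (h_L2 : IntegrableOn (fun p : ℝ × ℝ => (h p.1 p.2) ^ 2 / fInf T₁ T₂ α p.2)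
      (Torus ×ˢ (Set.univ : Set ℝ)))
    (h_moments : IntegrableOn (fun p : ℝ × ℝ => (1 + p.2 ^ 2) * |h p.1 p.2|)
      (Torus ×ˢ (Set.univ : Set ℝ))) :
    (∫ x in Torus, ∫ v : ℝ,
        h x v * Lop T₁ T₂ α c h x v / fInf T₁ T₂ α v)
      ≤ -((1 - α) / 2) *
          ∫ x in Torus, ∫ v : ℝ,
            (h x v - Pi0 T₁ T₂ α h x v) ^ 2 / fInf T₁ T₂ α v := by
  have hT : 0 < (T₁ + T₂) / 2 := by positivity
  have hα0 := hα.1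
  have hβ : 0 ≤ 1 - α := sub_nonneg.2 hα.2
  have hf := fInf_pos hT₁ hT₂ hα
  have hMm := (continuous_Maxwellian ((T₁ + T₂) / 2)).measurable
  have hfm := (continuous_fInf T₁ T₂ α).measurable
  obtain ⟨iU, hU⟩ := integral_energy_sq_mul_sq_Maxwellian_div_fInf hT₁ hT₂ hα
  let φ : ℝ → ℝ := fun v => c * (v ^ 2 / ((T₁ + T₂) / 2) - 1)
  let ψ : ℝ → ℝ := fun v =>
    α / (2 * c ^ 2) * (φ v * (Maxwellian ((T₁ + T₂) / 2) v / fInf T₁ T₂ α v))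
  have hφm : Measurable φ := by fun_prop
  have hψm : Measurable ψ := by fun_prop
  have hψf_eq : ∀ v, ψ v * fInf T₁ T₂ α v
      = α / (2 * c) * ((v ^ 2 / ((T₁ + T₂) / 2) - 1) * Maxwellian ((T₁ + T₂) / 2) v) := by
    intro v
    have := (hf v).ne'
    simp only [ψ, φ]
    generalize v ^ 2 / ((T₁ + T₂) / 2) - 1 = q
    field_simp
  have hφφ : (fun v => φ v ^ 2 * fInf T₁ T₂ α v) = fun v =>
      c ^ 2 * ((v ^ 2 / ((T₁ + T₂) / 2) - 1) ^ 2 * fInf T₁ T₂ α v) := by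
    ext v; simp only [φ]; ring
  have hψψ : (fun v => ψ v ^ 2 * fInf T₁ T₂ α v) = fun v =>
      1 / (4 * c ^ 2) * ((v ^ 2 / ((T₁ + T₂) / 2) - 1) ^ 2
        * (α ^ 2 * (Maxwellian ((T₁ + T₂) / 2) v ^ 2 / fInf T₁ T₂ α v))) := by
    ext v
    have := (hf v).ne'
    simp only [ψ, φ]
    generalize v ^ 2 / ((T₁ + T₂) / 2) - 1 = q
    field_simp
    ring
  have hφf : Integrable fun v => φ v ^ 2 * fInf T₁ T₂ α v := by
    rw [hφφ]
    exact (integrable_mul_fInf hT₁ hT₂ fun s hs =>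
      integrable_energy_sq_mul_Maxwellian hs _).const_mul _
  have hψf : Integrable fun v => ψ v ^ 2 * fInf T₁ T₂ α v := by
    rw [hψψ]; exact iU.const_mul _
  have hφ0 : ∫ v, φ v * fInf T₁ T₂ α v = 0 := by
    simp only [φ, mul_assoc, integral_const_mul, integral_energy_mul_fInf hT₁ hT₂, mul_zero]
  have hψ0 : ∫ v, ψ v * fInf T₁ T₂ α v = 0 := by
    simp only [hψf_eq, integral_const_mul, integral_energy_mul_Maxwellian hT]
    rw [div_self hT.ne', sub_self, mul_zero]
  have hφψ : ∫ v, φ v * ψ v * fInf T₁ T₂ α v = α := by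
    have : (fun v => φ v * ψ v * fInf T₁ T₂ α v) = fun v =>
        α / 2 * ((v ^ 2 / ((T₁ + T₂) / 2) - 1) ^ 2 * Maxwellian ((T₁ + T₂) / 2) v) := by
      ext v
      rw [mul_assoc, hψf_eq]
      simp only [φ]
      generalize v ^ 2 / ((T₁ + T₂) / 2) - 1 = q
      field_simp
    rw [this, integral_const_mul, integral_energy_sq_mul_Maxwellian hT, div_self hT.ne']
    ring
  have hψ1 : ∫ v, ψ v ^ 2 * fInf T₁ T₂ α v ≤ 1 := by
    have hV := integral_energy_sq_mul_fInf_le hT₁ hT₂ hα.2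
    have hcV : c ^ 2 * ∫ v, (v ^ 2 / ((T₁ + T₂) / 2) - 1) ^ 2 * fInf T₁ T₂ α v = 1 := by
      rw [← integral_const_mul, ← hφφ]; exact hc_norm
    have hc5 : 1 ≤ c ^ 2 * (2 * α + 5 * (1 - α)) :=
      hcV.symm.le.trans (mul_le_mul_of_nonneg_left hV (sq_nonneg c))
    rw [hψψ, integral_const_mul, one_div, inv_mul_le_iff₀ (by positivity), mul_one]
    refine hU.trans ?_
    have hK : 0 ≤ α * (1 + α) ^ 2 / 2 + α ^ 2 * (1 - α) := by positivity
    have hKV : (α * (1 + α) ^ 2 / 2 + α ^ 2 * (1 - α)) * (2 * α + 5 * (1 - α)) ≤ 4 := by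
      nlinarith [mul_nonneg (sq_nonneg (1 - α)) hα0, mul_nonneg (sq_nonneg (1 - α)) hβ,
        mul_nonneg (mul_nonneg (sq_nonneg (1 - α)) hα0) hα0,
        mul_nonneg (mul_nonneg (sq_nonneg (1 - α)) hα0) hβ, sq_nonneg (1 - α)]
    nlinarith [mul_le_mul_of_nonneg_left hc5 hK, mul_le_mul_of_nonneg_left hKV (sq_nonneg c)]
  have main := setIntegral_rank_two_le hα0 hf hfm hφm hψm (integrable_fInf hT₁ hT₂) hφf hψf
    (integral_fInf hT₁ hT₂) hφ0 hψ0 hc_norm hψ1 hφψ Torus h h_meas h_L2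
  have hL : ∀ x v, Lop T₁ T₂ α c h x v = (∫ w, h x w) * fInf T₁ T₂ α v
      + (∫ w, h x w * φ w) * (ψ v * fInf T₁ T₂ α v) - h x v := by
    intro x v
    simp only [Lop, Pi0, Pi2, ψ, φ]
    ring
  simpa only [hL, Pi0] using main
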